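/- Let A₁,…,A_s ∈ ℝ^{n×n}, A(σ) = Σ_{i=1}^s σ_i A_i, b ∈ ℝⁿ, and CK_j(A,b) = span{b} + Σ_{k=1}^{j−1} (column space of L^k(b)), where L is the linearisation function of A. Fix σ ∈ ℝ^s such that A(σ) is symmetric positive definite, let x(σ) solve A(σ) x = b, and let x̂_j(σ) be the subspace solution to this system from CK_j(A,b). Then ‖x(σ) − x̂_j(σ)‖_{A(σ)} ≤ 2 ((√κ − 1)/(√κ + 1))^j ‖x(σ)‖_{A(σ)}, where κ = λ_max(A(σ))/λ_min(A(σ)). -/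

import Mathlib

open Matrix BigOperators

/-- Index type for the `k`-fold Kronecker power of a vector in `ℝ^s`
(`kronIdx s k` has cardinality `s^k`). -/
abbrev kronIdx (s : ℕ) : ℕ → Type
  | 0 => Unit
  | k + 1 => Fin s × kronIdx s k

instance kronIdxFintype (s : ℕ) : ∀ k, Fintype (kronIdx s k)
  | 0 => inferInstanceAs (Fintype Unit)
  | k + 1 => @instFintypeProd _ _ _ (kronIdxFintype s k)

/-- The `k`-fold Kronecker product `σ^{⊗k}` of `σ ∈ ℝ^s` with itself:
`σ^{⊗1} = σ` and `σ^{⊗(k+1)} = σ ⊗ σ^{⊗k}`. -/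
def kronPow {s : ℕ} (σ : Fin s → ℝ) : ∀ k, kronIdx s k → ℝ
  | 0, _ => 1
  | k + 1, p => σ p.1 * kronPow σ k p.2

/-- The linearisation function `L` of `A(σ) = Σ σᵢ Aᵢ`, mapping
`C ∈ ℝ^{n×m}` to the block matrix `[A₁C ⋯ A_sC] ∈ ℝ^{n×sm}`. -/
def linFun {n s : ℕ} (A : Fin s → Matrix (Fin n) (Fin n) ℝ) {m : Type*}
    (C : Matrix (Fin n) m ℝ) : Matrix (Fin n) (Fin s × m) ℝ :=
  Matrix.of fun r p => (A p.1 * C) r p.2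

/-- `Lpow A b k = L^k(b)`, the `k`-fold application of the linearisation
function `L` to `b ∈ ℝⁿ` (viewed as an `n×1` matrix). -/
def Lpow {n s : ℕ} (A : Fin s → Matrix (Fin n) (Fin n) ℝ) (b : Fin n → ℝ) :
    ∀ k, Matrix (Fin n) (kronIdx s k) ℝ
  | 0 => Matrix.of fun r _ => b r
  | k + 1 => linFun A (Lpow A b k)


/-- The norm induced by a (s.p.d.) matrix `B`: `‖x‖_B = (xᵀ B x)^{1/2}`. -/
noncomputable def Bnorm {n : ℕ} (B : Matrix (Fin n) (Fin n) ℝ) (x : Fin n → ℝ) : ℝ :=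
  Real.sqrt (x ⬝ᵥ B.mulVec x)

/-- The compound Krylov subspace
`CK_j(A,b) = span{b} + Σ_{k=1}^{j−1} colspace(L^k(b))`. -/
noncomputable def CK {n s : ℕ} (A : Fin s → Matrix (Fin n) (Fin n) ℝ)
    (b : Fin n → ℝ) (j : ℕ) : Submodule ℝ (Fin n → ℝ) :=
  Submodule.span ℝ {b} ⊔ ⨆ k ∈ Finset.Icc 1 (j - 1), LinearMap.range (Lpow A b k).mulVecLin

open Polynomial in
/-- Rescaled Chebyshev polynomials: small on `[a, c]` and normalised at the origin. -/
theorem exists_polynomial_eval_zero_eq_one_abs_eval_le {a c : ℝ} (ha : 0 < a) (hac : a ≤ c)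
    {j : ℕ} (hj : 1 ≤ j) :
    ∃ p : ℝ[X], p.natDegree ≤ j ∧ p.eval 0 = 1 ∧ ∀ t ∈ Set.Icc a c,
      |p.eval t| ≤ 2 * ((√(c / a) - 1) / (√(c / a) + 1)) ^ j := by
  rcases hac.eq_or_lt with rfl | hlt
  · refine ⟨1 - C a⁻¹ * X, ?_, by simp, ?_⟩
    · refine (natDegree_sub_le _ _).trans ?_
      simpa using (natDegree_C_mul_le a⁻¹ X).trans (natDegree_X_le.trans hj)
    · intro t ht
      obtain rfl : t = a := le_antisymm ht.2 ht.1
      simp [ha.ne', (Nat.one_le_iff_ne_zero.mp hj)]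
  have hca : 0 < c - a := sub_pos.mpr hlt
  set w := √(c / a) with hw
  have hw1 : 1 < w := by
    rw [hw, Real.lt_sqrt zero_le_one]
    simpa using (one_lt_div ha).mpr hlt
  have hw2 : c = w ^ 2 * a := by
    rw [hw, Real.sq_sqrt (div_pos (ha.trans hlt) ha).le]
    field_simp
  have hwm : 0 < w - 1 := sub_pos.mpr hw1
  set r := (w + 1) / (w - 1) with hr
  have hrpos : 0 < r := by positivity
  have hrinv : (w - 1) / (w + 1) = r⁻¹ := by rw [hr, inv_div]
  set z := (c + a) / (c - a) with hz
  have hzr : z = Real.cosh (Real.log r) := by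
    rw [Real.cosh_log hrpos, hz, ← hrinv, hr, hw2]
    have h1 : w ^ 2 * a - a = a * (w - 1) * (w + 1) := by ring
    have h2 : w - 1 ≠ 0 := hwm.ne'
    have h3 : w + 1 ≠ 0 := by positivity
    rw [h1]
    field_simp
    ring
  have hTz : r ^ j / 2 ≤ (Chebyshev.T ℝ j).eval z := by
    rw [hzr, Chebyshev.T_real_cosh, Int.cast_natCast, ← Real.log_pow,
      Real.cosh_log (pow_pos hrpos j)]
    have : 0 < (r ^ j)⁻¹ := by positivity
    linarith
  have hTpos : 0 < (Chebyshev.T ℝ j).eval z := lt_of_lt_of_le (by positivity) hTz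
  refine ⟨C ((Chebyshev.T ℝ j).eval z)⁻¹ *
    (Chebyshev.T ℝ j).comp (C z - C (2 / (c - a)) * X), ?_, ?_, ?_⟩
  · refine (natDegree_C_mul_le _ _).trans (natDegree_comp_le.trans ?_)
    have h1 : (C z - C (2 / (c - a)) * X).natDegree ≤ 1 := by
      refine (natDegree_sub_le _ _).trans ?_
      simpa using (natDegree_C_mul_le (2 / (c - a)) X).trans natDegree_X_le
    have h2 : (Chebyshev.T ℝ j).natDegree = j := by simp [Chebyshev.natDegree_T]
    rw [h2]
    simpa using Nat.mul_le_mul_left j h1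
  · simp [hTpos.ne']
  · intro t ht
    have harg : |z - 2 / (c - a) * t| ≤ 1 := by
      have : z - 2 / (c - a) * t = (c + a - 2 * t) / (c - a) := by rw [hz]; ring
      rw [this, abs_div, abs_of_pos hca, div_le_one hca, abs_le]
      constructor <;> linarith [ht.1, ht.2]
    have hT := Chebyshev.abs_eval_T_real_le_one j harg
    simp only [eval_mul, eval_C, eval_comp, eval_sub, eval_X, abs_mul, abs_inv, abs_of_pos hTpos]
    calc _ ≤ ((Chebyshev.T ℝ j).eval z)⁻¹ * 1 := by gcongr
      _ ≤ (r ^ j / 2)⁻¹ := by rw [mul_one]; gcongr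
      _ = _ := by rw [hrinv, inv_div, inv_pow]; ring

theorem Lpow_mulVec_kronPow {n s : ℕ} (A : Fin s → Matrix (Fin n) (Fin n) ℝ) (b : Fin n → ℝ)
    (σ : Fin s → ℝ) (k : ℕ) :
    (Lpow A b k).mulVec (kronPow σ k) = ((∑ i, σ i • A i) ^ k).mulVec b := by
  induction k with
  | zero =>
    ext r
    change ∑ _u : Unit, b r * 1 = _
    simp
  | succ k ih =>
    rw [pow_succ', ← Matrix.mulVec_mulVec, ← ih, Matrix.sum_mulVec]
    ext r
    change ∑ p : Fin s × kronIdx s k, (A p.1 * Lpow A b k) r p.2 * (σ p.1 * kronPow σ k p.2) = _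
    rw [Fintype.sum_prod_type, Finset.sum_apply]
    refine Finset.sum_congr rfl fun i _ => ?_
    rw [Matrix.smul_mulVec, Matrix.mulVec_mulVec, Pi.smul_apply, smul_eq_mul, Matrix.mulVec,
      dotProduct, Finset.mul_sum]
    exact Finset.sum_congr rfl fun q _ => by ring

theorem pow_mulVec_mem_CK {n s : ℕ} (A : Fin s → Matrix (Fin n) (Fin n) ℝ) (b : Fin n → ℝ)
    (σ : Fin s → ℝ) {j k : ℕ} (hk : k < j) :
    ((∑ i, σ i • A i) ^ k).mulVec b ∈ CK A b j := by
  rcases Nat.eq_zero_or_pos k with rfl | hpos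
  · exact Submodule.mem_sup_left (by simp)
  · refine Submodule.mem_sup_right (Submodule.mem_iSup_of_mem k
      (Submodule.mem_iSup_of_mem (Finset.mem_Icc.mpr ⟨hpos, by omega⟩) ?_))
    exact ⟨kronPow σ k, Lpow_mulVec_kronPow A b σ k⟩

open Polynomial in
theorem aeval_mulVec_mem_CK {n s : ℕ} (A : Fin s → Matrix (Fin n) (Fin n) ℝ) (b : Fin n → ℝ)
    (σ : Fin s → ℝ) {j : ℕ} {q : ℝ[X]} (hq : q.natDegree < j) :
    (aeval (∑ i, σ i • A i) q).mulVec b ∈ CK A b j := by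
  rw [aeval_eq_sum_range' hq, Matrix.sum_mulVec]
  refine Submodule.sum_mem _ fun k hk => ?_
  rw [Matrix.smul_mulVec]
  exact Submodule.smul_mem _ _ (pow_mulVec_mem_CK A b σ (Finset.mem_range.mp hk))

namespace Matrix.IsHermitian

variable {n : ℕ} {B : Matrix (Fin n) (Fin n) ℝ} (hB : B.IsHermitian)

/-- The coordinates of a vector in an orthonormal eigenbasis of `B`. -/
noncomputable def eigenCoords (y : Fin n → ℝ) : Fin n → ℝ :=
  (star (hB.eigenvectorUnitary : Matrix (Fin n) (Fin n) ℝ)).mulVec y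

theorem eigenCoords_mulVec (y : Fin n → ℝ) (i : Fin n) :
    hB.eigenCoords (B.mulVec y) i = hB.eigenvalues i * hB.eigenCoords y i := by
  have h : star (hB.eigenvectorUnitary : Matrix (Fin n) (Fin n) ℝ) * B =
      diagonal hB.eigenvalues * star (hB.eigenvectorUnitary : Matrix (Fin n) (Fin n) ℝ) := by
    have hs := hB.spectral_theorem
    rw [Unitary.conjStarAlgAut_apply] at hs
    refine (congrArg (star (hB.eigenvectorUnitary : Matrix (Fin n) (Fin n) ℝ) * ·) hs).trans ?_
    rw [← mul_assoc, ← mul_assoc, Unitary.coe_star_mul_self, one_mul]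
    rfl
  rw [eigenCoords, mulVec_mulVec, h, ← mulVec_mulVec, mulVec_diagonal, eigenCoords]

theorem eigenCoords_aeval_mulVec (p : Polynomial ℝ) (y : Fin n → ℝ) (i : Fin n) :
    hB.eigenCoords ((Polynomial.aeval B p).mulVec y) i =
      p.eval (hB.eigenvalues i) * hB.eigenCoords y i := by
  induction p using Polynomial.induction_on generalizing y with
  | C a =>
    simp [eigenCoords, Algebra.algebraMap_eq_smul_one, smul_mulVec, mulVec_smul]
  | add p q hp hq =>
    have := congrArg₂ (· + ·) (hp y) (hq y)
    simp only [eigenCoords] at this ⊢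
    rw [map_add, add_mulVec, mulVec_add, Pi.add_apply, this, Polynomial.eval_add, add_mul]
  | monomial k a h =>
    rw [pow_succ, ← mul_assoc, map_mul, Polynomial.aeval_X, ← mulVec_mulVec, h,
      eigenCoords_mulVec, Polynomial.eval_mul_X, mul_assoc]

theorem dotProduct_mulVec_eq_sum_eigenCoords (y : Fin n → ℝ) :
    y ⬝ᵥ B.mulVec y = ∑ i, hB.eigenvalues i * hB.eigenCoords y i ^ 2 := by
  have h : ∀ u v : Fin n → ℝ, u ⬝ᵥ v = hB.eigenCoords u ⬝ᵥ hB.eigenCoords v := fun u v => by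
    rw [eigenCoords, eigenCoords, dotProduct_mulVec, vecMul_mulVec, star_eq_conjTranspose,
      conjTranspose_eq_transpose_of_trivial, transpose_transpose,
      ← conjTranspose_eq_transpose_of_trivial, ← star_eq_conjTranspose,
      Unitary.mul_star_self_of_mem hB.eigenvectorUnitary.2, vecMul_one]
  rw [h, dotProduct]
  exact Finset.sum_congr rfl fun i _ => by rw [eigenCoords_mulVec]; ring

end Matrix.IsHermitian

theorem Bnorm_aeval_mulVec_le {n : ℕ} {B : Matrix (Fin n) (Fin n) ℝ} (hB : B.PosDef)
    {p : Polynomial ℝ} {M : ℝ} (hM : 0 ≤ M) (hp : ∀ i, |p.eval (hB.1.eigenvalues i)| ≤ M)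
    (y : Fin n → ℝ) : Bnorm B ((Polynomial.aeval B p).mulVec y) ≤ M * Bnorm B y := by
  rw [Bnorm, Bnorm, ← Real.sqrt_sq hM, ← Real.sqrt_mul (sq_nonneg M)]
  refine Real.sqrt_le_sqrt ?_
  rw [hB.1.dotProduct_mulVec_eq_sum_eigenCoords, hB.1.dotProduct_mulVec_eq_sum_eigenCoords,
    Finset.mul_sum]
  refine Finset.sum_le_sum fun i _ => ?_
  rw [hB.1.eigenCoords_aeval_mulVec, mul_pow]
  have h1 : p.eval (hB.1.eigenvalues i) ^ 2 ≤ M ^ 2 := by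
    rw [← sq_abs]
    exact pow_le_pow_left₀ (abs_nonneg _) (hp i) 2
  have h2 : 0 ≤ hB.1.eigenvalues i * hB.1.eigenCoords y i ^ 2 :=
    mul_nonneg (hB.eigenvalues_pos i).le (sq_nonneg _)
  nlinarith [mul_le_mul_of_nonneg_right h1 h2]

/-- Galerkin orthogonality implies best approximation in the energy norm. -/
theorem Bnorm_sub_le_of_orthogonal {n : ℕ} {B : Matrix (Fin n) (Fin n) ℝ} (hB : B.PosSemidef)
    {V : Submodule ℝ (Fin n → ℝ)} {x xhat v : Fin n → ℝ} (hmem : xhat ∈ V)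
    (horth : ∀ u ∈ V, (x - xhat) ⬝ᵥ B.mulVec u = 0) (hv : v ∈ V) :
    Bnorm B (x - xhat) ≤ Bnorm B (x - v) := by
  refine Real.sqrt_le_sqrt ?_
  have hd := horth _ (V.sub_mem hmem hv)
  have hsymm : (xhat - v) ⬝ᵥ B.mulVec (x - xhat) = (x - xhat) ⬝ᵥ B.mulVec (xhat - v) := by
    rw [dotProduct_mulVec, dotProduct_comm, ← mulVec_transpose,
      ← conjTranspose_eq_transpose_of_trivial, hB.1.eq]
  have hnn : 0 ≤ (xhat - v) ⬝ᵥ B.mulVec (xhat - v) := by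
    simpa using hB.dotProduct_mulVec_nonneg (xhat - v)
  have hsplit : x - v = (x - xhat) + (xhat - v) := by abel
  rw [hsplit, mulVec_add, dotProduct_add, add_dotProduct, add_dotProduct, hsymm, hd]
  linarith

/-- the subspace solution to `A(σ)x = b` from the compound Krylov
subspace `CK_j(A,b)` satisfies the CG error bound
`‖x(σ) − x̂_j(σ)‖_{A(σ)} ≤ 2((√κ−1)/(√κ+1))^j ‖x(σ)‖_{A(σ)}`,
`κ = λmax(A(σ))/λmin(A(σ))`. -/
theorem stmt8 {n s : ℕ} (A : Fin s → Matrix (Fin n) (Fin n) ℝ) (b : Fin n → ℝ)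
    (σ : Fin s → ℝ) (Aσ : Matrix (Fin n) (Fin n) ℝ) (hAσ : Aσ = ∑ i, σ i • A i)
    (hpd : Aσ.PosDef) (j : ℕ) (hj : 1 ≤ j)
    (x xhat : Fin n → ℝ) (hx : Aσ.mulVec x = b)
    (hmem : xhat ∈ CK A b j)
    (horth : ∀ v ∈ CK A b j, (x - xhat) ⬝ᵥ Aσ.mulVec v = 0)
    (lmin lmax : ℝ)
    (hlmin : IsLeast (Set.range hpd.1.eigenvalues) lmin)
    (hlmax : IsGreatest (Set.range hpd.1.eigenvalues) lmax)
    (κ : ℝ) (hκ : κ = lmax / lmin) :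
    Bnorm Aσ (x - xhat) ≤ 2 * ((Real.sqrt κ - 1) / (Real.sqrt κ + 1)) ^ j * Bnorm Aσ x := by
  have hmin : ∀ i, lmin ≤ hpd.1.eigenvalues i := fun i => hlmin.2 ⟨i, rfl⟩
  have hmax : ∀ i, hpd.1.eigenvalues i ≤ lmax := fun i => hlmax.2 ⟨i, rfl⟩
  obtain ⟨i₀, hi₀⟩ := hlmin.1
  have hpos : 0 < lmin := hi₀ ▸ hpd.eigenvalues_pos i₀
  obtain ⟨p, hdeg, hp0, hp⟩ := exists_polynomial_eval_zero_eq_one_abs_eval_le hpos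
    ((hmin i₀).trans (hmax i₀)) hj
  rw [← hκ] at hp
  have hdecomp := p.divX_mul_X_add
  rw [Polynomial.coeff_zero_eq_eval_zero, hp0] at hdecomp
  have hres : x - -((Polynomial.aeval Aσ p.divX).mulVec b) = (Polynomial.aeval Aσ p).mulVec x := by
    conv_rhs => rw [← hdecomp]
    rw [map_add, map_mul, Polynomial.aeval_X, Polynomial.aeval_C, map_one, add_mulVec,
      ← mulVec_mulVec, hx, one_mulVec]
    abel
  have hmemp : -((Polynomial.aeval Aσ p.divX).mulVec b) ∈ CK A b j := by
    refine Submodule.neg_mem _ ?_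
    rw [hAσ]
    refine aeval_mulVec_mem_CK A b σ ?_
    rw [Polynomial.natDegree_divX_eq_natDegree_tsub_one]
    omega
  have hM := fun i => hp _ ⟨hmin i, hmax i⟩
  calc Bnorm Aσ (x - xhat)
      ≤ Bnorm Aσ (x - -((Polynomial.aeval Aσ p.divX).mulVec b)) :=
        Bnorm_sub_le_of_orthogonal hpd.posSemidef hmem horth hmemp
    _ = Bnorm Aσ ((Polynomial.aeval Aσ p).mulVec x) := by rw [hres]
    _ ≤ _ := Bnorm_aeval_mulVec_le hpd ((abs_nonneg _).trans (hM i₀)) hM x
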